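/- In the setting of the updated second-order ΣΔ scheme (filter h with h_0 = 0, h_1 = k/(k−1), h_j = 0 for 2 ≤ j ≤ k−1, h_k = 1 − k/(k−1); g finitely supported with Δ²g = δ⁰ − h; updated samples ỹ_n = f(2πn/N) + δ with δ = −(Δu)_{N−1}/N, satisfying ‖h‖_{ℓ¹} ≤ 2 − max_n |ỹ_n|), let f be K-bandlimited on the circle, N ≥ 2K+1, f̃ := f + δ, and let f̃_r be the reconstruction from the updated bits (q̃_n). Then for all t ∈ ℝ, |f̃(t) − f̃_r(t)| ≤ (2π·max_{0≤n≤N−1}|ũ_n| / N²)·(‖(φ^K)''‖_{L¹[0,2π]} + ‖(φ^K)'‖_∞). -/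

import Mathlib

noncomputable section
open Real
open scoped Classical

/-- sign(x) = 1 if x > 0, -1 if x ≤ 0. -/
def sgn (x : ℝ) : ℝ := if 0 < x then 1 else -1

/-- Backward difference of a sequence. -/
def bdiff (u : ℤ → ℝ) : ℤ → ℝ := fun n => u n - u (n - 1)

/-- The Dirichlet kernel `φᴷ`. -/
def dirichlet (K : ℕ) (x : ℝ) : ℝ :=
  if ∃ m : ℤ, x = 2 * π * m then 2 * K + 1
  else Real.sin ((2 * K + 1) * x / 2) / Real.sin (x / 2)

/-- `f : ℝ → ℝ` is `K`-bandlimited on the circle. -/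
def KBandlimited (K : ℕ) (f : ℝ → ℝ) : Prop :=
  ∃ c : ℤ → ℂ, ∀ t : ℝ, (f t : ℂ) =
    ∑ ξ ∈ Finset.Icc (-(K : ℤ)) (K : ℤ), c ξ * Complex.exp (Complex.I * ξ * t)

/-! ### The Dirichlet kernel as a trigonometric polynomial -/

lemma sin_eq_sin_half_mul_sum_cos (K : ℕ) (x : ℝ) :
    Real.sin ((2 * K + 1) * x / 2) =
      Real.sin (x / 2) * (1 + 2 * ∑ j ∈ Finset.range K, Real.cos ((j + 1) * x)) := by
  induction K with
  | zero => simp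
  | succ K ih =>
    rw [Finset.sum_range_succ, mul_add 2, ← add_assoc, mul_add (Real.sin (x / 2)), ← ih]
    have h1 : (2 * ((K + 1 : ℕ) : ℝ) + 1) * x / 2 = (K + 1) * x + x / 2 := by push_cast; ring
    have h2 : (2 * (K : ℝ) + 1) * x / 2 = (K + 1) * x - x / 2 := by ring
    rw [h1, h2, Real.sin_add, Real.sin_sub]
    ring

lemma dirichlet_eq_sum_cos (K : ℕ) (x : ℝ) :
    dirichlet K x = 1 + 2 * ∑ j ∈ Finset.range K, Real.cos ((j + 1) * x) := by
  unfold dirichlet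
  split_ifs with hx
  · obtain ⟨m, rfl⟩ := hx
    have hcos : ∀ j : ℕ, Real.cos ((j + 1) * (2 * π * m)) = 1 := fun j => by
      rw [show ((j : ℝ) + 1) * (2 * π * m) = (((j + 1) * m : ℤ) : ℝ) * (2 * π) by push_cast; ring]
      exact Real.cos_int_mul_two_pi _
    simp only [hcos, Finset.sum_const, Finset.card_range, nsmul_eq_mul]
    ring
  · have hs : Real.sin (x / 2) ≠ 0 := fun h0 => by
      obtain ⟨m, hm⟩ := Real.sin_eq_zero_iff.1 h0
      exact hx ⟨m, by linarith⟩
    rw [sin_eq_sin_half_mul_sum_cos, mul_div_cancel_left₀ _ hs]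

lemma sum_exp_Icc_eq_sum_cos (K : ℕ) (x : ℝ) :
    ∑ ξ ∈ Finset.Icc (-(K : ℤ)) (K : ℤ), Complex.exp (Complex.I * ξ * x) =
      ((1 + 2 * ∑ j ∈ Finset.range K, Real.cos ((j + 1) * x) : ℝ) : ℂ) := by
  induction K with
  | zero => simp
  | succ K ih =>
    have hset : Finset.Icc (-((K + 1 : ℕ) : ℤ)) ((K + 1 : ℕ) : ℤ) =
        insert (-((K : ℤ) + 1)) (insert ((K : ℤ) + 1) (Finset.Icc (-(K : ℤ)) K)) := by
      ext a
      simp only [Finset.mem_Icc, Finset.mem_insert]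
      omega
    rw [hset, Finset.sum_insert (by simp only [Finset.mem_insert, Finset.mem_Icc]; omega),
      Finset.sum_insert (by simp), ih, Finset.sum_range_succ]
    push_cast
    have hc : Complex.cos ((K + 1) * x) =
        (Complex.exp (Complex.I * (K + 1) * x) + Complex.exp (Complex.I * -(K + 1) * x)) / 2 := by
      rw [Complex.cos]
      ring_nf
    have hc' : Complex.I * (-1 + -(K : ℂ)) = Complex.I * -(K + 1) := by ring
    simp only [neg_add_rev, hc']
    rw [hc]
    ring

lemma dirichlet_eq_sum_exp (K : ℕ) (x : ℝ) :
    (dirichlet K x : ℂ) =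
      ∑ ξ ∈ Finset.Icc (-(K : ℤ)) (K : ℤ), Complex.exp (Complex.I * ξ * x) := by
  rw [dirichlet_eq_sum_cos, sum_exp_Icc_eq_sum_cos]

lemma contDiff_dirichlet (K : ℕ) {n : WithTop ℕ∞} : ContDiff ℝ n (dirichlet K) := by
  rw [funext (dirichlet_eq_sum_cos K)]
  exact contDiff_const.add (contDiff_const.mul (ContDiff.sum fun j _ =>
    Real.contDiff_cos.comp (contDiff_const.mul contDiff_id)))

lemma periodic_dirichlet (K : ℕ) : Function.Periodic (dirichlet K) (2 * π) := fun x => by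
  simp only [dirichlet_eq_sum_cos]
  congr 2
  refine Finset.sum_congr rfl fun j _ => ?_
  rw [show ((j : ℝ) + 1) * (x + 2 * π) = (j + 1) * x + ((j + 1 : ℕ) : ℝ) * (2 * π) by
    push_cast; ring]
  exact Real.cos_add_nat_mul_two_pi _ _

/-! ### The sampling theorem for bandlimited functions -/

lemma sum_exp_nodes {N : ℕ} (hN : 0 < N) {m : ℤ} (hm : |m| < N) :
    ∑ n ∈ Finset.range N, Complex.exp (Complex.I * m * (2 * π * n / N : ℝ)) =
      if m = 0 then (N : ℂ) else 0 := by
  split_ifs with h0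
  · simp [h0]
  have hNC : (N : ℂ) ≠ 0 := by exact_mod_cast hN.ne'
  set z : ℂ := Complex.exp (2 * π * Complex.I * m / N) with hz
  have hpow : ∀ n : ℕ, Complex.exp (Complex.I * m * (2 * π * n / N : ℝ)) = z ^ n := fun n => by
    rw [hz, ← Complex.exp_nat_mul]
    congr 1
    push_cast
    ring
  have hzN : z ^ N = 1 := by
    rw [hz, ← Complex.exp_nat_mul, Complex.exp_eq_one_iff]
    exact ⟨m, by field_simp⟩
  have hz1 : z ≠ 1 := fun h => by
    obtain ⟨l, hl⟩ := Complex.exp_eq_one_iff.1 h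
    have hml : (m : ℂ) = l * N := by
      have := Complex.two_pi_I_ne_zero
      field_simp at hl
      linear_combination hl
    have hml' : m = l * N := by exact_mod_cast hml
    exact h0 (Int.eq_zero_of_abs_lt_dvd ⟨l, by rw [hml', mul_comm]⟩ hm)
  simp only [hpow]
  rw [geom_sum_eq hz1, hzN, sub_self, zero_div]

lemma KBandlimited.add_const {K : ℕ} {f : ℝ → ℝ} (hf : KBandlimited K f) (δ : ℝ) :
    KBandlimited K fun t => f t + δ := by
  obtain ⟨c, hc⟩ := hf
  refine ⟨fun ξ => c ξ + if ξ = 0 then (δ : ℂ) else 0, fun t => ?_⟩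
  simp [hc t, add_mul, Finset.sum_add_distrib]

lemma KBandlimited.sampling {K N : ℕ} (hN : 2 * K + 1 ≤ N) {f : ℝ → ℝ}
    (hf : KBandlimited K f) (t : ℝ) :
    f t = (1 / N) * ∑ n ∈ Finset.range N,
      f (2 * π * n / N) * dirichlet K (t - 2 * π * n / N) := by
  obtain ⟨c, hc⟩ := hf
  have hN0 : 0 < N := by omega
  have hNC : (N : ℂ) ≠ 0 := by exact_mod_cast hN0.ne'
  apply Complex.ofReal_injective
  have key : ∑ n ∈ Finset.range N,
      (f (2 * π * n / N) : ℂ) * (dirichlet K (t - 2 * π * n / N) : ℂ) = N * (f t : ℂ) := by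
    calc _ = ∑ n ∈ Finset.range N, ∑ ξ ∈ Finset.Icc (-(K : ℤ)) K, ∑ η ∈ Finset.Icc (-(K : ℤ)) K,
          c ξ * Complex.exp (Complex.I * η * t) *
            Complex.exp (Complex.I * (ξ - η : ℤ) * (2 * π * n / N : ℝ)) := by
          refine Finset.sum_congr rfl fun n _ => ?_
          rw [hc, dirichlet_eq_sum_exp, Finset.sum_mul_sum]
          refine Finset.sum_congr rfl fun ξ _ => Finset.sum_congr rfl fun η _ => ?_
          rw [mul_assoc (c ξ), mul_assoc (c ξ), ← Complex.exp_add, ← Complex.exp_add]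
          congr 2
          push_cast
          ring
      _ = ∑ ξ ∈ Finset.Icc (-(K : ℤ)) K, ∑ η ∈ Finset.Icc (-(K : ℤ)) K,
          c ξ * Complex.exp (Complex.I * η * t) * (if ξ - η = 0 then (N : ℂ) else 0) := by
          rw [Finset.sum_comm]
          refine Finset.sum_congr rfl fun ξ hξ => ?_
          rw [Finset.sum_comm]
          refine Finset.sum_congr rfl fun η hη => ?_
          rw [← Finset.mul_sum, sum_exp_nodes hN0]
          rw [Finset.mem_Icc] at hξ hη
          rw [abs_lt]
          omega
      _ = _ := by
          rw [hc, Finset.mul_sum]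
          refine Finset.sum_congr rfl fun ξ hξ => ?_
          rw [Finset.sum_eq_single_of_mem ξ hξ fun η _ hne => by
            rw [if_neg (by omega), mul_zero], if_pos (sub_self ξ)]
          ring
  push_cast at key ⊢
  rw [key]
  field_simp

/-! ### Differences and convolutions of sequences -/

lemma eq_zero_of_bdiff_eq_zero {a : ℤ → ℝ} {M n₀ : ℤ} (hM : ∀ n ≤ M, a n = 0)
    (ha : ∀ n < n₀, bdiff a n = 0) : ∀ n < n₀, a n = 0 := fun n hn => by
  rcases le_total n M with h | h
  · exact hM n h
  · induction n, h using Int.leInduction with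
    | base => exact hM M le_rfl
    | succ n hMn ih =>
      have h1 := ha (n + 1) hn
      simp only [bdiff, add_sub_cancel_right] at h1
      linarith [ih (by omega)]

lemma exists_forall_le_eq_zero {a : ℤ → ℝ} (ha : (Function.support a).Finite) :
    ∃ M : ℤ, ∀ n ≤ M, a n = 0 := by
  obtain ⟨M, hM⟩ := ha.bddBelow
  refine ⟨M - 1, fun n hn => ?_⟩
  by_contra h
  have := hM (Function.mem_support.2 h)
  omega

lemma finite_support_bdiff {g : ℤ → ℝ} (hg : (Function.support g).Finite) :
    (Function.support (bdiff g)).Finite := by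
  refine (hg.union (hg.image fun n => n + 1)).subset fun n hn => ?_
  by_cases h : g n = 0
  · refine Or.inr ⟨n - 1, fun h1 => hn ?_, by ring⟩
    simp [bdiff, h, h1]
  · exact Or.inl h

lemma bdiff_conv {g v : ℤ → ℝ} (hg : (Function.support g).Finite) (n : ℤ) :
    bdiff (fun m => ∑ᶠ j : ℤ, g j * v (m - j)) n = ∑ᶠ j : ℤ, bdiff g j * v (n - j) := by
  have hfin : ∀ {a : ℤ → ℝ}, (Function.support a).Finite → ∀ w : ℤ → ℝ,
      (Function.support fun j => a j * w j).Finite := fun ha w =>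
    ha.subset fun j hj h => hj (by simp [h])
  have hshift : (Function.support fun j => g (j - 1)).Finite :=
    (hg.image fun n => n + 1).subset fun j hj => ⟨j - 1, hj, by ring⟩
  have h1 : ∑ᶠ j : ℤ, g j * v (n - 1 - j) = ∑ᶠ j : ℤ, g (j - 1) * v (n - j) := by
    rw [← finsum_comp_equiv (Equiv.subRight (1 : ℤ))]
    refine finsum_congr fun j => ?_
    simp only [Equiv.subRight_apply]
    congr 2
    ring
  simp only [bdiff]
  rw [h1, ← finsum_sub_distrib (hfin hg _) (hfin hshift _)]
  exact finsum_congr fun j => by ring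

lemma sum_bdiff_mul (u : ℤ → ℝ) (ψ : ℕ → ℝ) (N : ℕ) :
    ∑ n ∈ Finset.range N, bdiff u n * ψ n =
      ∑ n ∈ Finset.range N, u n * (ψ n - ψ (n + 1)) + u (N - 1) * ψ N - u (-1) * ψ 0 := by
  induction N with
  | zero => simp
  | succ N ih =>
    rw [Finset.sum_range_succ, ih, Finset.sum_range_succ]
    simp only [bdiff]
    push_cast
    rw [add_sub_cancel_right]
    ring

lemma sum_bdiff (u : ℤ → ℝ) (N : ℕ) :
    ∑ n ∈ Finset.range N, bdiff u n = u (N - 1) - u (-1) := by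
  simpa using sum_bdiff_mul u (fun _ => 1) N

/-! ### Sampled second differences of a periodic function -/

lemma sum_abs_second_diff_le {φ : ℝ → ℝ} (hφ : ContDiff ℝ 2 φ)
    (hper : Function.Periodic φ (2 * π)) {N : ℕ} (hN : 0 < N) (t : ℝ) :
    ∑ n ∈ Finset.range N, |(φ (t - 2 * π * n / N) - φ (t - 2 * π * (n + 1 : ℕ) / N)) -
        (φ (t - 2 * π * (n + 1 : ℕ) / N) - φ (t - 2 * π * (n + 1 + 1 : ℕ) / N))| ≤
      2 * π / N * ∫ x in (0 : ℝ)..(2 * π), |iteratedDeriv 2 φ x| := by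
  have hN' : (N : ℝ) ≠ 0 := by exact_mod_cast hN.ne'
  set s : ℝ := 2 * π / N with hs
  have hs0 : 0 ≤ s := by positivity
  set p : ℕ → ℝ := fun n => t - n * s with hp
  have hpn : ∀ n : ℕ, t - 2 * π * n / N = p n := fun n => by simp only [hp, hs]; ring
  have hpN : p N = t - 2 * π := by simp only [hp, hs]; field_simp
  have hpsucc : ∀ n, p (n + 1) = p n - s := fun n => by simp only [hp]; push_cast; ring
  have hd : ∀ x, HasDerivAt φ (deriv φ x) x := fun x =>
    (hφ.differentiable (by norm_num) x).hasDerivAt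
  have hφ1 : ContDiff ℝ 1 (deriv φ) := by
    have h2 : ContDiff ℝ (1 + 1) φ := by simpa [one_add_one_eq_two] using hφ
    exact (contDiff_succ_iff_deriv.1 h2).2.2
  have hdd : ∀ x, HasDerivAt (deriv φ) (iteratedDeriv 2 φ x) x := fun x => by
    rw [iteratedDeriv_succ, iteratedDeriv_one]
    exact (hφ1.differentiable (by norm_num) x).hasDerivAt
  have hc1 : Continuous (deriv φ) := hφ1.continuous
  have hc2 : Continuous (iteratedDeriv 2 φ) := hφ.continuous_iteratedDeriv 2 le_rfl
  have hper2 : Function.Periodic (fun x => |iteratedDeriv 2 φ x|) (2 * π) := fun x => by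
    have h := iteratedDeriv_comp_add_const (n := 2) (f := φ) (s := 2 * π)
    have h' := congrFun h x
    rw [show (fun z => φ (z + 2 * π)) = φ from funext hper] at h'
    simp only [← h']
  set H' : ℝ → ℝ := fun x => deriv φ x - deriv φ (x - s) with hH'
  have hcH : Continuous H' := by fun_prop
  have hstep : ∀ n : ℕ, |(φ (p n) - φ (p (n + 1))) - (φ (p (n + 1)) - φ (p (n + 1 + 1)))| ≤
      -∫ x in p n..p (n + 1), |H' x| := fun n => by
    have hint : ∫ x in p (n + 1)..p n, H' x =
        (φ (p n) - φ (p n - s)) - (φ (p (n + 1)) - φ (p (n + 1) - s)) :=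
      intervalIntegral.integral_eq_sub_of_hasDerivAt (f := fun x => φ x - φ (x - s))
        (fun x _ => (hd x).sub ((hd (x - s)).comp_sub_const x s)) (hcH.intervalIntegrable _ _)
    rw [← hpsucc, ← hpsucc] at hint
    rw [← hint, ← intervalIntegral.integral_symm]
    exact intervalIntegral.abs_integral_le_integral_abs (by rw [hpsucc]; linarith)
  have hpt : ∀ x, |H' x| ≤ ∫ r in (0 : ℝ)..s, |iteratedDeriv 2 φ (x - r)| := fun x => by
    have hint : ∫ r in (0 : ℝ)..s, iteratedDeriv 2 φ (x - r) = H' x := by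
      rw [intervalIntegral.integral_comp_sub_left (fun r => iteratedDeriv 2 φ r) x,
        intervalIntegral.integral_eq_sub_of_hasDerivAt (fun x _ => hdd x)
          (hc2.intervalIntegrable _ _), sub_zero]
    rw [← hint]
    exact intervalIntegral.abs_integral_le_integral_abs hs0
  calc _ ≤ ∑ n ∈ Finset.range N, -∫ x in p n..p (n + 1), |H' x| := by
        refine Finset.sum_le_sum fun n _ => ?_
        rw [hpn, hpn, hpn]
        exact hstep n
    _ = ∫ x in (t - 2 * π)..t, |H' x| := by
        rw [Finset.sum_neg_distrib, intervalIntegral.sum_integral_adjacent_intervals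
          fun n _ => hcH.abs.intervalIntegrable _ _, ← intervalIntegral.integral_symm, hpN]
        simp [hp]
    _ ≤ ∫ x in (t - 2 * π)..t, ∫ r in (0 : ℝ)..s, |iteratedDeriv 2 φ (x - r)| := by
        refine intervalIntegral.integral_mono_on (by linarith [Real.pi_pos])
          (hcH.abs.intervalIntegrable _ _) (Continuous.intervalIntegrable ?_ _ _)
          fun x _ => hpt x
        exact intervalIntegral.continuous_parametric_intervalIntegral_of_continuous'
          (by fun_prop) _ _
    _ = ∫ r in (0 : ℝ)..s, ∫ x in (t - 2 * π)..t, |iteratedDeriv 2 φ (x - r)| := by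
        refine MeasureTheory.intervalIntegral_intervalIntegral_swap ?_
        have hc : Continuous (Function.uncurry fun x r : ℝ => |iteratedDeriv 2 φ (x - r)|) :=
          (hc2.comp (continuous_fst.sub continuous_snd)).abs
        exact (hc.continuousOn.integrableOn_compact
          (isCompact_uIcc.prod isCompact_uIcc)).mono_set
          (Set.prod_mono Set.uIoc_subset_uIcc Set.uIoc_subset_uIcc)
    _ = ∫ r in (0 : ℝ)..s, ∫ x in (0 : ℝ)..(2 * π), |iteratedDeriv 2 φ x| := by
        refine intervalIntegral.integral_congr fun r _ => ?_
        rw [intervalIntegral.integral_comp_sub_right (fun x => |iteratedDeriv 2 φ x|) r]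
        have h := hper2.intervalIntegral_add_eq (t - 2 * π - r) 0
        rw [zero_add] at h
        rw [← h]
        congr 1
        ring
    _ = _ := by simp

lemma bddAbove_abs_deriv_of_periodic {φ : ℝ → ℝ} (hφ : ContDiff ℝ 2 φ)
    (hper : Function.Periodic φ (2 * π)) : BddAbove (Set.range fun x => |deriv φ x|) := by
  have hc : Continuous fun x => |deriv φ x| := (hφ.continuous_deriv (by norm_num)).abs
  have hp : Function.Periodic (fun x => |deriv φ x|) (2 * π) := fun x => by
    have h := deriv_comp_add_const φ (2 * π) x
    rw [show (fun z => φ (z + 2 * π)) = φ from funext hper] at h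
    simp only [h]
  obtain ⟨C, hC⟩ := (isCompact_Icc (a := (0 : ℝ)) (b := 2 * π)).bddAbove_image hc.continuousOn
  refine ⟨C, ?_⟩
  rintro _ ⟨x, rfl⟩
  obtain ⟨z, hz, hxz⟩ := hp.exists_mem_Ico₀ Real.two_pi_pos x
  exact hxz.trans_le (hC ⟨z, Set.Ico_subset_Icc_self hz, rfl⟩)

lemma abs_sub_le_mul_iSup_abs_deriv {φ : ℝ → ℝ} (hφ : ContDiff ℝ 2 φ)
    (hper : Function.Periodic φ (2 * π)) (x z : ℝ) :
    |φ x - φ z| ≤ (⨆ w : ℝ, |deriv φ w|) * |x - z| := by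
  have h := convex_univ.norm_image_sub_le_of_norm_deriv_le (𝕜 := ℝ) (f := φ)
    (C := ⨆ w : ℝ, |deriv φ w|) (fun w _ => hφ.differentiable (by norm_num) w)
    (fun w _ => le_ciSup (bddAbove_abs_deriv_of_periodic hφ hper) w)
    (Set.mem_univ z) (Set.mem_univ x)
  simpa only [Real.norm_eq_abs] using h

lemma abs_sum_bdiff_bdiff_mul_le {φ : ℝ → ℝ} (hφ : ContDiff ℝ 2 φ)
    (hper : Function.Periodic φ (2 * π)) {N : ℕ} (hN : 0 < N) {u : ℤ → ℝ}
    (hu : ∀ n < 0, u n = 0) (hend : bdiff u (N - 1) = 0) (t : ℝ) :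
    |∑ n ∈ Finset.range N, bdiff (bdiff u) n * φ (t - 2 * π * n / N)| ≤
      2 * π * (⨆ n : Fin N, |u ((n : ℕ) : ℤ)|) / N *
        ((∫ x in (0 : ℝ)..(2 * π), |iteratedDeriv 2 φ x|) + ⨆ x : ℝ, |deriv φ x|) := by
  set U := ⨆ n : Fin N, |u ((n : ℕ) : ℤ)|
  have hle : ∀ n < N, |u n| ≤ U := fun n hn =>
    le_ciSup (f := fun n : Fin N => |u ((n : ℕ) : ℤ)|) (Set.finite_range _).bddAbove ⟨n, hn⟩
  have hU0 : 0 ≤ U := (abs_nonneg _).trans (hle 0 hN)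
  have hlast : |u (N - 1)| ≤ U := by
    have := hle (N - 1) (by omega)
    rwa [Nat.cast_sub hN, Nat.cast_one] at this
  have h0 : bdiff u (-1) = 0 := by simp [bdiff, hu]
  rw [sum_bdiff_mul (bdiff u) (fun n => φ (t - 2 * π * n / N)), hend, h0, zero_mul, zero_mul,
    add_zero, sub_zero, sum_bdiff_mul u fun n : ℕ =>
      φ (t - 2 * π * n / N) - φ (t - 2 * π * (n + 1 : ℕ) / N), hu (-1) (by norm_num), zero_mul,
    sub_zero]
  have h1 := sum_abs_second_diff_le hφ hper hN t
  have h2 := abs_sub_le_mul_iSup_abs_deriv hφ hper (t - 2 * π * N / N)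
    (t - 2 * π * (N + 1 : ℕ) / N)
  have hstep : |t - 2 * π * N / N - (t - 2 * π * (N + 1 : ℕ) / N)| = 2 * π / N := by
    rw [← abs_of_nonneg (show 0 ≤ 2 * π / N by positivity)]
    congr 1
    push_cast
    ring
  rw [hstep] at h2
  refine (abs_add_le _ _).trans ?_
  rw [abs_mul]
  have h3 := mul_le_mul hlast h2 (abs_nonneg _) hU0
  refine (add_le_add ((Finset.abs_sum_le_sum_abs _ _).trans
    ((Finset.sum_le_sum fun n hn => ?_).trans
      ((Finset.mul_sum _ _ U).symm.trans_le (mul_le_mul_of_nonneg_left h1 hU0)))) h3).trans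
    (le_of_eq (by ring))
  rw [abs_mul]
  exact mul_le_mul_of_nonneg_right (hle n (Finset.mem_range.1 hn)) (abs_nonneg _)

/-! ### The ΣΔ scheme with a two-tab filter -/

lemma exists_sgn_eq (x : ℝ) : ∃ m : ℤ, sgn x = 2 * m + 1 := by
  unfold sgn
  split_ifs
  · exact ⟨0, by norm_num⟩
  · exact ⟨-1, by norm_num⟩

lemma abs_sub_sgn_bounds {a b y r x : ℝ} (ha : |a| ≤ 1) (hb : |b| ≤ 1) (hr : 0 < r)
    (hy : |y| ≤ 1 - 2 * r) (hx : x = (1 + r) * a - r * b + y) :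
    |x - sgn x| ≤ 1 ∧ |x - sgn x - r * a| < 1 + r := by
  rw [abs_le] at ha hb hy
  have h1 : r * a ≤ r := by nlinarith
  have h2 : -r ≤ r * a := by nlinarith
  have h3 : r * b ≤ r := by nlinarith
  have h4 : -r ≤ r * b := by nlinarith
  unfold sgn
  split_ifs with h0
  · rw [abs_le, abs_lt]
    refine ⟨⟨?_, ?_⟩, ?_, ?_⟩ <;> linarith
  · rw [abs_le, abs_lt]
    refine ⟨⟨?_, ?_⟩, ?_, ?_⟩
    · linarith
    · linarith
    · linarith
    · rcases ha.1.eq_or_lt with h | h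
      · subst h
        linarith
      · nlinarith

/-- The filter `h` of the scheme, with `k` tabs of which only the first and last are nonzero. -/
def IsTwoTabFilter (k : ℕ) (h : ℤ → ℝ) : Prop :=
  ∀ j : ℤ, h j =
    if j = 1 then (k : ℝ) / ((k : ℝ) - 1)
    else if j = (k : ℤ) then 1 - (k : ℝ) / ((k : ℝ) - 1) else 0

namespace IsTwoTabFilter

variable {k : ℕ} {h : ℤ → ℝ}

lemma apply_one (hh : IsTwoTabFilter k h) (hk : 2 ≤ k) : h 1 = 1 + 1 / ((k : ℝ) - 1) := by
  have : (k : ℝ) - 1 ≠ 0 := by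
    have : (2 : ℝ) ≤ k := by exact_mod_cast hk
    linarith
  rw [hh, if_pos rfl]
  field_simp
  ring

lemma apply_last (hh : IsTwoTabFilter k h) (hk : 2 ≤ k) : h k = -(1 / ((k : ℝ) - 1)) := by
  have : (k : ℝ) - 1 ≠ 0 := by
    have : (2 : ℝ) ≤ k := by exact_mod_cast hk
    linarith
  rw [hh, if_neg (by omega), if_pos rfl]
  field_simp
  ring

lemma apply_of_ne (hh : IsTwoTabFilter k h) {j : ℤ} (h1 : j ≠ 1) (hk : j ≠ k) : h j = 0 := by
  rw [hh, if_neg h1, if_neg hk]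

lemma sum_eq (hh : IsTwoTabFilter k h) (hk : 2 ≤ k) {s : Finset ℤ} (h1 : 1 ∈ s) (hks : (k : ℤ) ∈ s)
    {F : ℤ → ℝ} (hF : ∀ j, h j = 0 → F j = 0) : ∑ j ∈ s, F j = F 1 + F k := by
  refine Finset.sum_eq_add_of_mem 1 (k : ℤ) h1 hks (by omega) fun j _ hj => ?_
  exact hF j (hh.apply_of_ne hj.1 hj.2)

lemma sum_abs (hh : IsTwoTabFilter k h) (hk : 2 ≤ k) :
    ∑ j ∈ Finset.Icc (0 : ℤ) (k : ℤ), |h j| = 1 + 2 * (1 / ((k : ℝ) - 1)) := by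
  have hr : (0 : ℝ) ≤ 1 / ((k : ℝ) - 1) := by
    have : (2 : ℝ) ≤ k := by exact_mod_cast hk
    exact div_nonneg zero_le_one (by linarith)
  rw [hh.sum_eq hk (by simp; omega) (by simp) (fun j hj => by simp [hj]), hh.apply_one hk,
    hh.apply_last hk, abs_neg, abs_of_nonneg hr, abs_of_nonneg (by linarith)]
  ring

lemma conv_eq (hh : IsTwoTabFilter k h) (hk : 2 ≤ k) (v : ℤ → ℝ) (n : ℤ) :
    ∑ j ∈ Finset.Icc (1 : ℤ) (k : ℤ), h j * v (n - j) =
      (1 + 1 / ((k : ℝ) - 1)) * v (n - 1) - 1 / ((k : ℝ) - 1) * v (n - k) := by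
  rw [hh.sum_eq hk (by simp; omega) (by simp; omega) (fun j hj => by simp [hj]),
    hh.apply_one hk, hh.apply_last hk]
  ring

lemma bdiff_eq (hh : IsTwoTabFilter k h) (hk : 2 ≤ k) {g : ℤ → ℝ}
    (hgfin : (Function.support g).Finite)
    (hg : ∀ n : ℤ, bdiff (bdiff g) n = (if n = 0 then (1 : ℝ) else 0) - h n) (n : ℤ) :
    bdiff g n =
      if n = 0 then 1 else if 0 < n ∧ n < k then -(1 / ((k : ℝ) - 1)) else 0 := by
  set D : ℤ → ℝ := fun n =>
    if n = 0 then 1 else if 0 < n ∧ n < k then -(1 / ((k : ℝ) - 1)) else 0 with hD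
  obtain ⟨M, hM⟩ := exists_forall_le_eq_zero (finite_support_bdiff hgfin)
  have hzero := eq_zero_of_bdiff_eq_zero (a := fun n => bdiff g n - D n) (M := min M (-1))
    (n₀ := n + 1) (fun m hm => ?_) (fun m _ => ?_) n (by omega)
  · exact sub_eq_zero.1 hzero
  · simp only [hM m (hm.trans (min_le_left _ _)), hD]
    have : m ≤ -1 := hm.trans (min_le_right _ _)
    rw [if_neg (by omega), if_neg (by omega), sub_zero]
  · have hgm := hg m
    have hDm : D m - D (m - 1) = (if m = 0 then (1 : ℝ) else 0) - h m := by
      rcases eq_or_ne m 1 with rfl | h1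
      · rw [hh.apply_one hk]
        simp only [hD]
        rw [if_neg one_ne_zero, if_pos ⟨by norm_num, by omega⟩, if_pos (by norm_num),
          if_neg one_ne_zero]
        ring
      rcases eq_or_ne m k with rfl | h2
      · rw [hh.apply_last hk]
        simp only [hD]
        rw [if_neg (by omega), if_neg (by omega), if_neg (by omega), if_pos (by omega),
          if_neg (by omega)]
      · rw [hh.apply_of_ne h1 h2]
        simp only [hD]
        split_ifs <;> first | omega | simp
    simp only [bdiff] at hgm ⊢
    linarith

lemma eq_zero_of_neg (hh : IsTwoTabFilter k h) (hk : 2 ≤ k) {g : ℤ → ℝ}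
    (hgfin : (Function.support g).Finite)
    (hg : ∀ n : ℤ, bdiff (bdiff g) n = (if n = 0 then (1 : ℝ) else 0) - h n) :
    ∀ n < 0, g n = 0 := by
  obtain ⟨M, hM⟩ := exists_forall_le_eq_zero hgfin
  refine eq_zero_of_bdiff_eq_zero hM fun n hn => ?_
  rw [hh.bdiff_eq hk hgfin hg, if_neg (by omega), if_neg (by omega)]

lemma conv_eq_zero_of_neg (hh : IsTwoTabFilter k h) (hk : 2 ≤ k) {g : ℤ → ℝ}
    (hgfin : (Function.support g).Finite)
    (hg : ∀ n : ℤ, bdiff (bdiff g) n = (if n = 0 then (1 : ℝ) else 0) - h n)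
    {u v : ℤ → ℝ} (hu : ∀ n : ℤ, u n = ∑ᶠ j : ℤ, g j * v (n - j)) (hv0 : ∀ n < 0, v n = 0) :
    ∀ n < 0, u n = 0 := fun n hn => by
  rw [hu]
  refine finsum_eq_zero_of_forall_eq_zero fun j => ?_
  rcases lt_or_ge j 0 with hj | hj
  · rw [hh.eq_zero_of_neg hk hgfin hg j hj, zero_mul]
  · rw [hv0 _ (by omega), mul_zero]

lemma bdiff_state_eq (hh : IsTwoTabFilter k h) (hk : 2 ≤ k) {g : ℤ → ℝ}
    (hgfin : (Function.support g).Finite)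
    (hg : ∀ n : ℤ, bdiff (bdiff g) n = (if n = 0 then (1 : ℝ) else 0) - h n)
    {u v : ℤ → ℝ} (hu : ∀ n : ℤ, u n = ∑ᶠ j : ℤ, g j * v (n - j)) (n : ℤ) :
    bdiff u n = v n - 1 / ((k : ℝ) - 1) * v (n - 1) -
      1 / ((k : ℝ) - 1) * ∑ j ∈ Finset.Icc (2 : ℤ) (k - 1), v (n - j) := by
  rw [funext hu, bdiff_conv hgfin]
  have hsupp : (Function.support fun j => bdiff g j * v (n - j)) ⊆
      ((insert 0 (insert 1 (Finset.Icc (2 : ℤ) (k - 1))) : Finset ℤ) : Set ℤ) := fun j hj => by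
    by_contra hj'
    simp only [Finset.coe_insert, Finset.coe_Icc, Set.mem_insert_iff, Set.mem_Icc] at hj'
    refine hj ?_
    simp only
    rw [hh.bdiff_eq hk hgfin hg, if_neg (by omega), if_neg (by omega), zero_mul]
  rw [finsum_eq_sum_of_support_subset _ hsupp, Finset.sum_insert (by simp),
    Finset.sum_insert (by simp), Finset.mul_sum, hh.bdiff_eq hk hgfin hg 0, if_pos rfl,
    hh.bdiff_eq hk hgfin hg 1, if_neg one_ne_zero, if_pos ⟨by norm_num, by omega⟩]
  have hrest : ∑ j ∈ Finset.Icc (2 : ℤ) (k - 1), bdiff g j * v (n - j) =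
      -∑ j ∈ Finset.Icc (2 : ℤ) (k - 1), 1 / ((k : ℝ) - 1) * v (n - j) := by
    rw [← Finset.sum_neg_distrib]
    refine Finset.sum_congr rfl fun j hj => ?_
    rw [Finset.mem_Icc] at hj
    rw [hh.bdiff_eq hk hgfin hg, if_neg (by omega), if_pos (by omega), neg_mul]
  rw [hrest, sub_zero]
  ring

lemma bdiff_bdiff_state_eq (hh : IsTwoTabFilter k h) (hk : 2 ≤ k) {g : ℤ → ℝ}
    (hgfin : (Function.support g).Finite)
    (hg : ∀ n : ℤ, bdiff (bdiff g) n = (if n = 0 then (1 : ℝ) else 0) - h n)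
    {u v : ℤ → ℝ} (hu : ∀ n : ℤ, u n = ∑ᶠ j : ℤ, g j * v (n - j)) (n : ℤ) :
    bdiff (bdiff u) n = v n - ∑ j ∈ Finset.Icc (1 : ℤ) (k : ℤ), h j * v (n - j) := by
  have h1 : bdiff u = fun m => ∑ᶠ j : ℤ, bdiff g j * v (m - j) := by
    rw [funext hu]
    exact funext fun m => bdiff_conv hgfin m
  rw [h1, bdiff_conv (finite_support_bdiff hgfin)]
  have hsupp : (Function.support fun j => bdiff (bdiff g) j * v (n - j)) ⊆
      ((insert 0 (Finset.Icc (1 : ℤ) k) : Finset ℤ) : Set ℤ) := fun j hj => by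
    by_contra hj'
    simp only [Finset.coe_insert, Finset.coe_Icc, Set.mem_insert_iff, Set.mem_Icc] at hj'
    refine hj ?_
    simp only
    rw [hg, if_neg (by omega), hh.apply_of_ne (by omega) (by omega), sub_zero, zero_mul]
  rw [finsum_eq_sum_of_support_subset _ hsupp, Finset.sum_insert (by simp), hg 0, if_pos rfl,
    hh.apply_of_ne zero_ne_one (by omega), sub_zero, sub_zero, one_mul, sub_eq_add_neg,
    ← Finset.sum_neg_distrib]
  congr 1
  refine Finset.sum_congr rfl fun j hj => ?_
  rw [Finset.mem_Icc] at hj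
  rw [hg, if_neg (by omega), zero_sub, neg_mul]

/-- Stability of the scheme, with the strict estimate that excludes the extreme transition. -/
lemma stable (hh : IsTwoTabFilter k h) (hk : 2 ≤ k) {N : ℕ} {y q v : ℤ → ℝ}
    (hy : ∀ n : ℤ, 0 ≤ n → n < N → |y n| ≤ 1 - 2 * (1 / ((k : ℝ) - 1)))
    (hv0 : ∀ n < 0, v n = 0)
    (hq : ∀ n : ℤ, 0 ≤ n → n < N →
      q n = sgn ((∑ j ∈ Finset.Icc (1 : ℤ) (k : ℤ), h j * v (n - j)) + y n))
    (hv : ∀ n : ℤ, 0 ≤ n → n < N →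
      v n = (∑ j ∈ Finset.Icc (1 : ℤ) (k : ℤ), h j * v (n - j)) + y n - q n)
    (n : ℤ) (hn : n < N) :
    |v n| ≤ 1 ∧ |v n - 1 / ((k : ℝ) - 1) * v (n - 1)| < 1 + 1 / ((k : ℝ) - 1) := by
  have hr : (0 : ℝ) < 1 / ((k : ℝ) - 1) := by
    have : (2 : ℝ) ≤ k := by exact_mod_cast hk
    exact div_pos one_pos (by linarith)
  have hneg : ∀ m < 0, |v m| ≤ 1 := fun m hm => by simp [hv0 m hm]
  have step : ∀ n : ℤ, 0 ≤ n → n < N → (∀ m < n, |v m| ≤ 1) →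
      |v n| ≤ 1 ∧ |v n - 1 / ((k : ℝ) - 1) * v (n - 1)| < 1 + 1 / ((k : ℝ) - 1) :=
    fun n h0 hn ih => by
      have hx := hh.conv_eq hk v n
      rw [hv n h0 hn, hq n h0 hn]
      exact abs_sub_sgn_bounds (ih (n - 1) (by omega)) (ih (n - k) (by omega)) hr (hy n h0 hn)
        (by rw [hx])
  have hall : ∀ m : ℕ, ∀ n : ℤ, n < m → n < N → |v n| ≤ 1 := fun m => by
    induction m with
    | zero => exact fun n hn _ => hneg n (by exact_mod_cast hn)
    | succ m ih =>
      intro n hn hnN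
      rcases lt_or_ge n 0 with h0 | h0
      · exact hneg n h0
      · exact (step n h0 hnN fun l hl => ih l (by push_cast at hn; omega) (by omega)).1
  rcases lt_or_ge n 0 with h0 | h0
  · rw [hv0 n h0, hv0 (n - 1) (by omega)]
    simp only [mul_zero, sub_zero, abs_zero]
    exact ⟨zero_le_one, by linarith⟩
  · exact step n h0 hn fun m hm => hall N m (by omega) (by omega)

lemma abs_bdiff_state_lt_two (hh : IsTwoTabFilter k h) (hk : 2 ≤ k) {g : ℤ → ℝ}
    (hgfin : (Function.support g).Finite)
    (hg : ∀ n : ℤ, bdiff (bdiff g) n = (if n = 0 then (1 : ℝ) else 0) - h n)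
    {u v : ℤ → ℝ} (hu : ∀ n : ℤ, u n = ∑ᶠ j : ℤ, g j * v (n - j)) (n : ℤ)
    (hv : ∀ m ≤ n, |v m| ≤ 1)
    (hv' : |v n - 1 / ((k : ℝ) - 1) * v (n - 1)| < 1 + 1 / ((k : ℝ) - 1)) :
    |bdiff u n| < 2 := by
  have hk1 : (0 : ℝ) < (k : ℝ) - 1 := by
    have : (2 : ℝ) ≤ k := by exact_mod_cast hk
    linarith
  have hr : (0 : ℝ) < 1 / ((k : ℝ) - 1) := div_pos one_pos hk1
  have hcard : ((Finset.Icc (2 : ℤ) (k - 1)).card : ℝ) = (k : ℝ) - 2 := by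
    rw [Int.card_Icc, show ((k : ℤ) - 1 + 1 - 2).toNat = k - 2 by omega, Nat.cast_sub hk]
    norm_num
  have hsum : |∑ j ∈ Finset.Icc (2 : ℤ) (k - 1), v (n - j)| ≤ (k : ℝ) - 2 := by
    refine (Finset.abs_sum_le_sum_abs _ _).trans ?_
    have hle := Finset.sum_le_card_nsmul (Finset.Icc (2 : ℤ) (k - 1)) (fun j => |v (n - j)|) 1
      fun j hj => hv (n - j) (by rw [Finset.mem_Icc] at hj; omega)
    rwa [nsmul_one, hcard] at hle
  rw [hh.bdiff_state_eq hk hgfin hg hu]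
  refine (abs_sub _ _).trans_lt ?_
  rw [abs_mul, abs_of_pos hr]
  have h1 := mul_le_mul_of_nonneg_left hsum hr.le
  have h2 : 1 / ((k : ℝ) - 1) * ((k : ℝ) - 2) = 1 - 1 / ((k : ℝ) - 1) := by
    field_simp
    ring
  linarith

end IsTwoTabFilter

/-- **Error bound for the updated second-order ΣΔ scheme on the circle.**
In the setting of the updated second-order ΣΔ scheme (filter `h` with `k` tabs,
`Δ²g = δ⁰ - h`, samples `yₙ = f(2πn/N)` of a `K`-bandlimited `f`, update
`δ = -(Δu)_{N-1}/N` satisfying the stability criterion), the shifted function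
`f̃ = f + δ` and the reconstruction `f̃ᵣ` from the updated bits `q̃` satisfy
`|f̃(t) - f̃ᵣ(t)| ≤ (2π · maxₙ|ũₙ| / N²) · (‖(φᴷ)''‖_{L¹[0,2π]} + ‖(φᴷ)'‖_∞)`. -/
theorem second_order_updated_error (k : ℕ) (hk : 2 ≤ k) (h g : ℤ → ℝ)
    (hh : ∀ j : ℤ, h j =
      if j = 1 then (k : ℝ) / ((k : ℝ) - 1)
      else if j = (k : ℤ) then 1 - (k : ℝ) / ((k : ℝ) - 1) else 0)
    (hgfin : (Function.support g).Finite)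
    (hg : ∀ n : ℤ, bdiff (bdiff g) n = (if n = 0 then (1 : ℝ) else 0) - h n)
    (K N : ℕ) (hN : 2 * K + 1 ≤ N)
    (f : ℝ → ℝ) (hf : KBandlimited K f)
    (y v q u vv qq uu : ℤ → ℝ)
    (hy : ∀ n : ℤ, 0 ≤ n → n < (N : ℤ) → y n = f (2 * π * n / N))
    (hv0 : ∀ n : ℤ, n < 0 → v n = 0)
    (hq : ∀ n : ℤ, 0 ≤ n → n < (N : ℤ) →
      q n = sgn ((∑ j ∈ Finset.Icc (1 : ℤ) (k : ℤ), h j * v (n - j)) + y n))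
    (hv : ∀ n : ℤ, 0 ≤ n → n < (N : ℤ) →
      v n = (∑ j ∈ Finset.Icc (1 : ℤ) (k : ℤ), h j * v (n - j)) + y n - q n)
    (hu : ∀ n : ℤ, u n = ∑ᶠ j : ℤ, g j * v (n - j))
    (δ : ℝ) (hδ : δ = -(bdiff u ((N : ℤ) - 1)) / N)
    (hstab : ∑ j ∈ Finset.Icc (0 : ℤ) (k : ℤ), |h j| ≤
      2 - ⨆ n : Fin N, |y ((n : ℕ) : ℤ) + δ|)
    (hvv0 : ∀ n : ℤ, n < 0 → vv n = 0)
    (hqq : ∀ n : ℤ, 0 ≤ n → n < (N : ℤ) →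
      qq n = sgn ((∑ j ∈ Finset.Icc (1 : ℤ) (k : ℤ), h j * vv (n - j)) + (y n + δ)))
    (hvv : ∀ n : ℤ, 0 ≤ n → n < (N : ℤ) →
      vv n = (∑ j ∈ Finset.Icc (1 : ℤ) (k : ℤ), h j * vv (n - j)) + (y n + δ) - qq n)
    (huu : ∀ n : ℤ, uu n = ∑ᶠ j : ℤ, g j * vv (n - j)) :
    ∀ t : ℝ,
      |(f t + δ) - (1 / N) * ∑ n ∈ Finset.range N, qq n * dirichlet K (t - 2 * π * n / N)| ≤
        (2 * π * (⨆ n : Fin N, |uu ((n : ℕ) : ℤ)|) / (N : ℝ) ^ 2) *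
          ((∫ x in (0 : ℝ)..(2 * π), |iteratedDeriv 2 (dirichlet K) x|) +
            ⨆ x : ℝ, |deriv (dirichlet K) x|) := by
  intro t
  replace hh : IsTwoTabFilter k h := hh
  have hN0 : 0 < N := by omega
  have hN' : (0 : ℝ) < N := by exact_mod_cast hN0
  have hu0 := hh.conv_eq_zero_of_neg hk hgfin hg hu hv0
  have huu0 := hh.conv_eq_zero_of_neg hk hgfin hg huu hvv0
  have hΔ : ∀ n ∈ Finset.range N, bdiff (bdiff u) (n : ℤ) = y n - q n := fun n hn => by
    rw [hh.bdiff_bdiff_state_eq hk hgfin hg hu,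
      hv n (by positivity) (by exact_mod_cast Finset.mem_range.1 hn)]
    ring
  have hΔΔ : ∀ n ∈ Finset.range N, bdiff (bdiff uu) (n : ℤ) = y n + δ - qq n := fun n hn => by
    rw [hh.bdiff_bdiff_state_eq hk hgfin hg huu,
      hvv n (by positivity) (by exact_mod_cast Finset.mem_range.1 hn)]
    ring
  have hybd : ∀ n : ℤ, 0 ≤ n → n < N → |y n + δ| ≤ 1 - 2 * (1 / ((k : ℝ) - 1)) :=
    fun n h0 hn => by
      lift n to ℕ using h0
      have hle := le_ciSup (f := fun n : Fin N => |y ((n : ℕ) : ℤ) + δ|)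
        (Set.finite_range _).bddAbove ⟨n, by exact_mod_cast hn⟩
      rw [hh.sum_abs hk] at hstab
      simp only at hle
      linarith
  have hst := hh.stable hk (y := fun n => y n + δ) hybd hvv0 hqq hvv
  have hlt := hh.abs_bdiff_state_lt_two hk hgfin hg huu (N - 1)
    (fun m hm => (hst m (by omega)).1) (hst (N - 1) (by omega)).2
  have hend : bdiff uu (N - 1) = 0 := by
    have hsum : ∑ n ∈ Finset.range N, (y n - q n) = bdiff u (N - 1) := by
      rw [← Finset.sum_congr rfl hΔ, sum_bdiff]
      simp [bdiff, hu0]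
    have hsum' : ∑ n ∈ Finset.range N, (y n + δ - qq n) = bdiff uu (N - 1) := by
      rw [← Finset.sum_congr rfl hΔΔ, sum_bdiff]
      simp [bdiff, huu0]
    have hNδ : N * δ = -bdiff u (N - 1) := by
      rw [hδ]
      field_simp
    choose m hm using exists_sgn_eq
    have hdiff : bdiff uu (N - 1) = ∑ n ∈ Finset.range N, (q n - qq n) := by
      have : ∑ n ∈ Finset.range N, (y n + δ - qq n) =
          ∑ n ∈ Finset.range N, (y n - q n) + N * δ + ∑ n ∈ Finset.range N, (q n - qq n) := by
        simp only [Finset.sum_sub_distrib, Finset.sum_add_distrib, Finset.sum_const,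
          Finset.card_range, nsmul_eq_mul]
        ring
      rw [← hsum', this, hsum, hNδ]
      ring
    have heven : ∃ l : ℤ, bdiff uu (N - 1) = 2 * l := by
      refine ⟨∑ n ∈ Finset.range N,
        (m ((∑ j ∈ Finset.Icc (1 : ℤ) (k : ℤ), h j * v (n - j)) + y n) -
          m ((∑ j ∈ Finset.Icc (1 : ℤ) (k : ℤ), h j * vv (n - j)) + (y n + δ))), ?_⟩
      rw [hdiff]
      push_cast
      rw [Finset.mul_sum]
      refine Finset.sum_congr rfl fun n hn => ?_
      have hn' : (n : ℤ) < N := by exact_mod_cast Finset.mem_range.1 hn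
      rw [hq n (by positivity) hn', hqq n (by positivity) hn', hm, hm]
      ring
    obtain ⟨l, hl⟩ := heven
    rw [hl, abs_lt] at hlt
    have hl1 : (-1 : ℤ) < l := by exact_mod_cast (by linarith [hlt.1] : (-1 : ℝ) < l)
    have hl2 : l < (1 : ℤ) := by exact_mod_cast (by linarith [hlt.2] : (l : ℝ) < 1)
    rw [hl, show l = 0 by omega]
    simp
  have herr : (f t + δ) -
      (1 / N) * ∑ n ∈ Finset.range N, qq n * dirichlet K (t - 2 * π * n / N) =
      (1 / N) * ∑ n ∈ Finset.range N,
        bdiff (bdiff uu) n * dirichlet K (t - 2 * π * n / N) := by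
    rw [(hf.add_const δ).sampling hN t, ← mul_sub, ← Finset.sum_sub_distrib]
    congr 1
    refine Finset.sum_congr rfl fun n hn => ?_
    rw [hΔΔ n hn, hy n (by positivity) (by exact_mod_cast Finset.mem_range.1 hn)]
    push_cast
    ring
  rw [herr, abs_mul, abs_of_pos (by positivity)]
  refine (mul_le_mul_of_nonneg_left (abs_sum_bdiff_bdiff_mul_le (contDiff_dirichlet K)
    (periodic_dirichlet K) hN0 huu0 hend t) (by positivity)).trans (le_of_eq ?_)
  field_simp
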